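/- arXiv:2305.09605 — 3 statements merged into one kernel-verified Lean document; each statement's English description precedes it below -/
import Mathlib

section
/- Let g : ℝ^d → ℝ be L-Lipschitz with respect to the Euclidean norm, and let Q be a probability measure on ℝ^d with finite second moment. For t ≥ 0 and x ∈ ℝ^d define ḡ_{t,x}(z) = g(e^{-t} x + (1-e^{-2t})^{1/2} z) - g(0). Then for all t, t' ≥ 0 and x, x' ∈ ℝ^d, ‖ḡ_{t,x} - ḡ_{t',x'}‖_{L²(Q)} ≤ L(1 + √2 ‖z‖_{L²(Q)}) · ρ_OU((t,x), (t',x')), where ρ_OU((t,x), (t',x')) = ‖e^{-t} x - e^{-t'} x'‖ + |t - t'|^{1/2}. -/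
open MeasureTheory Real
open scoped NNReal

theorem abs_sqrt_sub_sqrt_le_sqrt_abs_sub {u v : ℝ} (hu : 0 ≤ u) (hv : 0 ≤ v) :
    |√u - √v| ≤ √|u - v| := by
  apply Real.le_sqrt_of_sq_le
  have h : |u - v| = |√u - √v| * (√u + √v) := by
    rw [← abs_of_nonneg (add_nonneg (sqrt_nonneg u) (sqrt_nonneg v)), ← abs_mul]
    congr 1
    nlinarith [sq_sqrt hu, sq_sqrt hv]
  rw [h, sq]
  gcongr
  rw [abs_le]
  constructor <;> linarith [sqrt_nonneg u, sqrt_nonneg v]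

theorem abs_exp_neg_sub_exp_neg_le {s t : ℝ} (hs : 0 ≤ s) (ht : 0 ≤ t) :
    |exp (-s) - exp (-t)| ≤ |s - t| := by
  wlog h : s ≤ t generalizing s t
  · rw [abs_sub_comm, abs_sub_comm s]
    exact this ht hs (le_of_not_ge h)
  rw [abs_of_nonneg (sub_nonneg.2 (exp_le_exp.2 (neg_le_neg h))), abs_sub_comm,
    abs_of_nonneg (sub_nonneg.2 h)]
  have h1 : exp (-t) = exp (-s) * exp (s - t) := by
    rw [← exp_add]
    ring_nf
  have h2 : exp (-s) ≤ 1 := exp_le_one_iff.2 (by linarith)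
  nlinarith [add_one_le_exp (s - t), exp_pos (-s)]

theorem abs_sqrt_one_sub_exp_sub_le {t t' : ℝ} (ht : 0 ≤ t) (ht' : 0 ≤ t') :
    |√(1 - exp (-2 * t)) - √(1 - exp (-2 * t'))| ≤ √2 * √|t - t'| := by
  have h {s : ℝ} (hs : 0 ≤ s) : 0 ≤ 1 - exp (-2 * s) :=
    sub_nonneg.2 (exp_le_one_iff.2 (by linarith))
  refine (abs_sqrt_sub_sqrt_le_sqrt_abs_sub (h ht) (h ht')).trans ?_
  rw [← sqrt_mul zero_le_two]
  apply sqrt_le_sqrt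
  have key := abs_exp_neg_sub_exp_neg_le (mul_nonneg zero_le_two ht') (mul_nonneg zero_le_two ht)
  rw [← mul_sub, abs_mul, abs_two, abs_sub_comm t'] at key
  convert key using 2
  ring_nf

/-- Minkowski's inequality in `L²(Q)` for the sum of a constant and a multiple of the norm. -/
theorem integral_add_mul_norm_sq_le {E : Type*} [NormedAddCommGroup E] [MeasurableSpace E]
    [OpensMeasurableSpace E] (Q : Measure E) [IsProbabilityMeasure Q]
    (hQ : Integrable (fun z => ‖z‖ ^ 2) Q) {a b : ℝ} (ha : 0 ≤ a) (hb : 0 ≤ b) :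
    Integrable (fun z => (a + b * ‖z‖) ^ 2) Q ∧
      ∫ z, (a + b * ‖z‖) ^ 2 ∂Q ≤ (a + b * √(∫ z, ‖z‖ ^ 2 ∂Q)) ^ 2 := by
  have h1 : Integrable (fun z : E => ‖z‖) Q := by
    refine ((integrable_const 1).add hQ).mono' measurable_norm.aestronglyMeasurable ?_
    refine .of_forall fun z => ?_
    simp only [Pi.add_apply, norm_norm]
    nlinarith [sq_nonneg (‖z‖ - 1)]
  have expand (a b : ℝ) : (fun z : E => (a + b * ‖z‖) ^ 2) =
      fun z => (a ^ 2 + 2 * a * b * ‖z‖) + b ^ 2 * ‖z‖ ^ 2 := by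
    ext z
    ring
  have hlin (a b : ℝ) : Integrable (fun z : E => a ^ 2 + 2 * a * b * ‖z‖) Q :=
    (integrable_const _).add (h1.const_mul _)
  have hint (a b : ℝ) : ∫ z, (a + b * ‖z‖) ^ 2 ∂Q =
      a ^ 2 + 2 * a * b * ∫ z, ‖z‖ ∂Q + b ^ 2 * ∫ z, ‖z‖ ^ 2 ∂Q := by
    rw [expand, integral_add (hlin a b) (hQ.const_mul _),
      integral_add (integrable_const _) (h1.const_mul _), integral_const_mul, integral_const_mul]
    simp
  refine ⟨by rw [expand]; exact (hlin a b).add (hQ.const_mul _), ?_⟩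
  have hm : ∫ z, ‖z‖ ∂Q ≤ √(∫ z, ‖z‖ ^ 2 ∂Q) := by
    apply le_sqrt_of_sq_le
    have h := hint (-∫ z, ‖z‖ ∂Q) 1
    have h0 : 0 ≤ ∫ z, (-(∫ z, ‖z‖ ∂Q) + 1 * ‖z‖) ^ 2 ∂Q :=
      integral_nonneg fun z => sq_nonneg _
    nlinarith
  rw [hint]
  have hM : √(∫ z, ‖z‖ ^ 2 ∂Q) ^ 2 = ∫ z, ‖z‖ ^ 2 ∂Q :=
    sq_sqrt (integral_nonneg fun z => sq_nonneg _)
  nlinarith [mul_le_mul_of_nonneg_left hm (mul_nonneg ha hb)]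

/-- `L²(Q)` Lipschitz condition for the centred terminal cost
`ḡ_{t,x}(z) = g(e^{-t}x + (1-e^{-2t})^{1/2} z) - g(0)` with respect to the metric
`ρ_OU((t,x),(t',x')) = ‖e^{-t}x - e^{-t'}x'‖ + |t-t'|^{1/2}`. -/
theorem stmt_5 (d : ℕ) (hd : 1 ≤ d)
    (L : ℝ≥0) (g : EuclideanSpace ℝ (Fin d) → ℝ) (hg : LipschitzWith L g)
    (Q : Measure (EuclideanSpace ℝ (Fin d))) [IsProbabilityMeasure Q]
    (hQ : Integrable (fun z => ‖z‖ ^ 2) Q)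
    (gbar : ℝ → EuclideanSpace ℝ (Fin d) → EuclideanSpace ℝ (Fin d) → ℝ)
    (hgbar : ∀ t x z, gbar t x z =
      g (exp (-t) • x + Real.sqrt (1 - exp (-2 * t)) • z) - g 0)
    (t t' : ℝ) (ht : 0 ≤ t) (ht' : 0 ≤ t')
    (x x' : EuclideanSpace ℝ (Fin d)) :
    Real.sqrt (∫ z, (gbar t x z - gbar t' x' z) ^ 2 ∂Q) ≤
      L * (1 + Real.sqrt 2 * Real.sqrt (∫ z, ‖z‖ ^ 2 ∂Q)) *
        (‖exp (-t) • x - exp (-t') • x'‖ + Real.sqrt |t - t'|) := by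
  set a := ‖exp (-t) • x - exp (-t') • x'‖
  set b := |√(1 - exp (-2 * t)) - √(1 - exp (-2 * t'))|
  set N := √(∫ z, ‖z‖ ^ 2 ∂Q)
  have ha0 : 0 ≤ a := norm_nonneg _
  have hb0 : 0 ≤ b := abs_nonneg _
  have hN0 : 0 ≤ N := sqrt_nonneg _
  have hbt : b ≤ √2 * √|t - t'| := abs_sqrt_one_sub_exp_sub_le ht ht'
  have pointwise (z : EuclideanSpace ℝ (Fin d)) :
      (gbar t x z - gbar t' x' z) ^ 2 ≤ (L * a + L * b * ‖z‖) ^ 2 := by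
    rw [hgbar, hgbar, sub_sub_sub_cancel_right]
    refine sq_le_sq.2 (le_trans ?_ (le_abs_self _))
    rw [← Real.dist_eq]
    refine (hg.dist_le_mul _ _).trans ?_
    rw [mul_assoc, ← mul_add, dist_eq_norm, add_sub_add_comm, ← sub_smul]
    refine mul_le_mul_of_nonneg_left ((norm_add_le _ _).trans ?_) L.coe_nonneg
    rw [norm_smul, Real.norm_eq_abs]
  obtain ⟨hi, hle⟩ := integral_add_mul_norm_sq_le Q hQ
    (mul_nonneg L.coe_nonneg ha0) (mul_nonneg L.coe_nonneg hb0)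
  have hsq : ∫ z, (gbar t x z - gbar t' x' z) ^ 2 ∂Q ≤ (L * a + L * b * N) ^ 2 :=
    (integral_mono_of_nonneg (.of_forall fun z => sq_nonneg _) hi (.of_forall pointwise)).trans hle
  clear_value a b N
  calc √(∫ z, (gbar t x z - gbar t' x' z) ^ 2 ∂Q)
      ≤ L * a + L * b * N := sqrt_le_iff.2 ⟨by positivity, hsq⟩
    _ ≤ L * a + L * (√2 * √|t - t'|) * N := by gcongr
    _ ≤ L * (1 + √2 * N) * (a + √|t - t'|) := by
      have h1 : 0 ≤ L * (√2 * N * a) := by positivity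
      have h2 : 0 ≤ L * √|t - t'| := by positivity
      linarith
end

section
/- Let g : ℝ^d → ℝ be L-Lipschitz, let Q be a probability measure on ℝ^d with finite second moment, fix T > 0, R > 0, ε > 0, and set C = L(1 + √2 ‖z‖_{L²(Q)}). Define ḡ_{t,x}(z) = g(e^{-t} x + (1-e^{-2t})^{1/2} z) - g(0) and G = {ḡ_{t,x} : x ∈ B^d(R), t ∈ [0,T]} ⊆ L²(Q). Then the covering number of G in the L²(Q) norm satisfies N(G, L²(Q), Cε) ≤ N([0,T], |·|, ε²/4) · N(B^d(R), ‖·‖, ε/2). -/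
open MeasureTheory Real
open scoped NNReal

/-- The covering number `N(A, ρ, ε)`: the smallest cardinality of a subset `S ⊆ A`
such that every point of `A` is within `ρ`-distance `ε` of some point of `S`. -/
noncomputable def coveringNumber {α : Type*} (A : Set α) (ρ : α → α → ℝ) (ε : ℝ) : ℕ∞ :=
  sInf {n : ℕ∞ | ∃ S : Set α, S ⊆ A ∧ S.encard = n ∧ ∀ a ∈ A, ∃ s ∈ S, ρ a s ≤ ε}

/-- The infimum defining the covering number is attained. -/
theorem exists_encard_eq_coveringNumber {α : Type*} (A : Set α) {ρ : α → α → ℝ} {ε : ℝ}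
    (hρ : ∀ a ∈ A, ρ a a ≤ ε) :
    ∃ S ⊆ A, S.encard = coveringNumber A ρ ε ∧ ∀ a ∈ A, ∃ s ∈ S, ρ a s ≤ ε :=
  csInf_mem (s := {n : ℕ∞ | ∃ S : Set α, S ⊆ A ∧ S.encard = n ∧ ∀ a ∈ A, ∃ s ∈ S, ρ a s ≤ ε})
    ⟨A.encard, A, subset_rfl, rfl, fun a ha => ⟨a, ha, hρ a ha⟩⟩

theorem coveringNumber_le_encard {α : Type*} {A S : Set α} {ρ : α → α → ℝ} {ε : ℝ}
    (hS : S ⊆ A) (hcov : ∀ a ∈ A, ∃ s ∈ S, ρ a s ≤ ε) : coveringNumber A ρ ε ≤ S.encard :=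
  csInf_le (OrderBot.bddBelow _) ⟨S, hS, rfl, hcov⟩

theorem abs_sqrt_one_sub_exp_sub_le_s10 {l t ε : ℝ} (hl : 0 ≤ l) (hlt : l ≤ t) (hε : 0 ≤ ε)
    (h : t - l ≤ ε ^ 2 / 2) :
    |√(1 - exp (-2 * t)) - √(1 - exp (-2 * l))| ≤ ε := by
  have hmono : √(1 - exp (-2 * l)) ≤ √(1 - exp (-2 * t)) := by
    gcongr √(1 - exp ?_)
    linarith
  rw [abs_of_nonneg (by linarith), sub_le_iff_le_add, Real.sqrt_le_iff]
  refine ⟨by positivity, ?_⟩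
  have hl1 : exp (-2 * l) ≤ 1 := exp_le_one_iff.2 (by linarith)
  have hsq := Real.sq_sqrt (sub_nonneg.2 hl1)
  have hmul : exp (-2 * t) = exp (-2 * l) * exp (-2 * (t - l)) := by
    rw [← exp_add]; ring_nf
  have hlow := add_one_le_exp (-2 * (t - l))
  have hprod : 0 ≤ ε * √(1 - exp (-2 * l)) := by positivity
  nlinarith [exp_pos (-2 * l)]

/-- If `|u z| ≤ L (ε / 2 + ε ‖z‖)`, then `‖u‖_{L²(Q)} ≤ L (1 + √2 ‖z‖_{L²(Q)}) ε`. -/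
theorem sqrt_integral_sq_le {E : Type*} [NormedAddCommGroup E] [MeasurableSpace E]
    {Q : Measure E} [IsProbabilityMeasure Q] (hQ : Integrable (fun z => ‖z‖ ^ 2) Q)
    {L ε : ℝ} (hL : 0 ≤ L) (hε : 0 ≤ ε) {u : E → ℝ}
    (hu : ∀ z, |u z| ≤ L * (ε / 2 + ε * ‖z‖)) :
    √(∫ z, u z ^ 2 ∂Q) ≤ L * (1 + √2 * √(∫ z, ‖z‖ ^ 2 ∂Q)) * ε := by
  have hint : ∫ z, u z ^ 2 ∂Q ≤ ∫ z, (L * ε) ^ 2 * (1 / 2 + 2 * ‖z‖ ^ 2) ∂Q := by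
    refine integral_mono_of_nonneg (.of_forall fun z => sq_nonneg _)
      (((integrable_const _).add (hQ.const_mul 2)).const_mul _) (.of_forall fun z => ?_)
    calc u z ^ 2 ≤ (L * (ε / 2 + ε * ‖z‖)) ^ 2 := sq_le_sq' (abs_le.1 (hu z)).1 (abs_le.1 (hu z)).2
      _ = (L * ε) ^ 2 * (1 / 2 + ‖z‖) ^ 2 := by ring
      _ ≤ (L * ε) ^ 2 * (1 / 2 + 2 * ‖z‖ ^ 2) := by
        gcongr
        nlinarith [sq_nonneg (‖z‖ - 1 / 2)]
  rw [integral_const_mul, integral_add (integrable_const _) (hQ.const_mul 2),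
    integral_const_mul] at hint
  simp only [integral_const, probReal_univ, one_smul] at hint
  have hm : 0 ≤ ∫ z, ‖z‖ ^ 2 ∂Q := integral_nonneg fun z => by positivity
  refine Real.sqrt_le_iff.2 ⟨by positivity, hint.trans ?_⟩
  calc (L * ε) ^ 2 * (1 / 2 + 2 * ∫ z, ‖z‖ ^ 2 ∂Q)
      ≤ (L * ε) ^ 2 * (1 + √2 * √(∫ z, ‖z‖ ^ 2 ∂Q)) ^ 2 := by
        gcongr
        have h2 : (√2 * √(∫ z, ‖z‖ ^ 2 ∂Q)) ^ 2 = 2 * ∫ z, ‖z‖ ^ 2 ∂Q := by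
          rw [mul_pow, Real.sq_sqrt zero_le_two, Real.sq_sqrt hm]
        have h3 : 0 ≤ √2 * √(∫ z, ‖z‖ ^ 2 ∂Q) := by positivity
        nlinarith
    _ = _ := by ring

/-- Covering number of the terminal-cost function class
`G = {ḡ_{t,x} : x ∈ B^d(R), t ∈ [0,T]}` in `L²(Q)`:
`N(G, L²(Q), Cε) ≤ N([0,T], |·|, ε²/4) · N(B^d(R), ‖·‖, ε/2)`
with `C = L(1 + √2 ‖z‖_{L²(Q)})`. -/
theorem stmt_10 (d : ℕ) (hd : 1 ≤ d)
    (L : ℝ≥0) (g : EuclideanSpace ℝ (Fin d) → ℝ) (hg : LipschitzWith L g)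
    (Q : Measure (EuclideanSpace ℝ (Fin d))) [IsProbabilityMeasure Q]
    (hQ : Integrable (fun z => ‖z‖ ^ 2) Q)
    (T R ε : ℝ) (hT : 0 < T) (hR : 0 < R) (hε : 0 < ε)
    (C : ℝ) (hC : C = L * (1 + Real.sqrt 2 * Real.sqrt (∫ z, ‖z‖ ^ 2 ∂Q)))
    (gbar : ℝ → EuclideanSpace ℝ (Fin d) → EuclideanSpace ℝ (Fin d) → ℝ)
    (hgbar : ∀ t x z, gbar t x z =
      g (exp (-t) • x + Real.sqrt (1 - exp (-2 * t)) • z) - g 0)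
    (distL2 : (EuclideanSpace ℝ (Fin d) → ℝ) → (EuclideanSpace ℝ (Fin d) → ℝ) → ℝ)
    (hdistL2 : ∀ h h', distL2 h h' = Real.sqrt (∫ z, (h z - h' z) ^ 2 ∂Q))
    (G : Set (EuclideanSpace ℝ (Fin d) → ℝ))
    (hG : G = {h | ∃ t ∈ Set.Icc (0 : ℝ) T,
      ∃ x ∈ Metric.closedBall (0 : EuclideanSpace ℝ (Fin d)) R, h = gbar t x}) :
    coveringNumber G distL2 (C * ε) ≤
      coveringNumber (Set.Icc (0 : ℝ) T) (fun s t => |s - t|) (ε ^ 2 / 4) *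
        coveringNumber (Metric.closedBall (0 : EuclideanSpace ℝ (Fin d)) R)
          (fun x y => ‖x - y‖) (ε / 2) := by
  obtain ⟨S, hSsub, hScard, hS⟩ := exists_encard_eq_coveringNumber (Set.Icc (0 : ℝ) T)
    (ρ := fun s t => |s - t|) (ε := ε ^ 2 / 4) (fun a _ => by simp; positivity)
  obtain ⟨X, hXsub, hXcard, hX⟩ := exists_encard_eq_coveringNumber
    (Metric.closedBall (0 : EuclideanSpace ℝ (Fin d)) R)
    (ρ := fun x y => ‖x - y‖) (ε := ε / 2) (fun a _ => by simp; positivity)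
  rw [← hScard, ← hXcard, ← Set.encard_prod]
  -- Time centers move to the left ends of their intervals, which keeps `exp (left s - t) • x` in the ball.
  let left : ℝ → ℝ := fun s => max 0 (s - ε ^ 2 / 4)
  refine (coveringNumber_le_encard (S := (fun p => gbar (left p.1) p.2) '' S ×ˢ X) ?_ ?_).trans
    (Set.encard_image_le _ _)
  · rintro _ ⟨⟨s, y⟩, ⟨hs, hy⟩, rfl⟩
    rw [hG]
    refine ⟨left s, ⟨le_max_left _ _, max_le hT.le ?_⟩, y, hXsub hy, rfl⟩
    linarith [(hSsub hs).2, sq_nonneg ε]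
  · rw [hG]
    rintro _ ⟨t, ht, x, hx, rfl⟩
    obtain ⟨s, hs, hts⟩ := hS t ht
    rw [abs_le] at hts
    have hl : 0 ≤ left s := le_max_left _ _
    have hlt : left s ≤ t := max_le ht.1 (by linarith)
    have htl : t - left s ≤ ε ^ 2 / 2 := by
      linarith [le_max_right 0 (s - ε ^ 2 / 4)]
    have hx' : exp (left s - t) • x ∈ Metric.closedBall (0 : EuclideanSpace ℝ (Fin d)) R := by
      rw [mem_closedBall_zero_iff] at hx ⊢
      rw [norm_smul, Real.norm_of_nonneg (exp_pos _).le]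
      exact (mul_le_of_le_one_left (norm_nonneg x) (exp_le_one_iff.2 (by linarith))).trans hx
    obtain ⟨y, hy, hxy⟩ := hX _ hx'
    refine ⟨gbar (left s) y, ⟨(s, y), ⟨hs, hy⟩, rfl⟩, ?_⟩
    rw [hdistL2, hC]
    refine sqrt_integral_sq_le hQ L.coe_nonneg hε.le fun z => ?_
    have hsplit : exp (-t) • x + √(1 - exp (-2 * t)) • z
        - (exp (-left s) • y + √(1 - exp (-2 * left s)) • z)
        = exp (-left s) • (exp (left s - t) • x - y)
          + (√(1 - exp (-2 * t)) - √(1 - exp (-2 * left s))) • z := by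
      have hexp : exp (-t) = exp (-left s) * exp (left s - t) := by
        rw [← exp_add]; ring_nf
      rw [hexp]
      module
    rw [hgbar, hgbar, sub_sub_sub_cancel_right, ← Real.dist_eq]
    refine (hg.dist_le_mul _ _).trans ?_
    rw [dist_eq_norm, hsplit]
    gcongr
    refine (norm_add_le _ _).trans (add_le_add ?_ ?_)
    · rw [norm_smul, Real.norm_of_nonneg (exp_pos _).le]
      exact (mul_le_of_le_one_left (norm_nonneg _) (exp_le_one_iff.2 (by linarith))).trans hxy
    · rw [norm_smul, Real.norm_eq_abs]
      gcongr
      exact abs_sqrt_one_sub_exp_sub_le_s10 hl hlt hε.le htl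
end

section
/- Let f : ℝ^d → ℝ be differentiable with f ≥ c everywhere for some c ∈ (0,1], and suppose both f and ∇f are L-Lipschitz with respect to the Euclidean norm. Then for every t ≥ 0 the vector field x ↦ ∇ log U_t f(x) is well defined, bounded in Euclidean norm by L/c, and Lipschitz with constant L/c + L²/c²: for all x, y ∈ ℝ^d, ‖∇ log U_t f(x)‖ ≤ L/c and ‖∇ log U_t f(x) - ∇ log U_t f(y)‖ ≤ (L/c + L²/c²)‖x - y‖. -/
open MeasureTheory Real
open scoped NNReal

/-- If `g ≥ c > 0` and its derivative is bounded by `L` and `L`-Lipschitz, then the derivative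
of `log g` is bounded by `L / c` and Lipschitz with constant `L / c + L ^ 2 / c ^ 2`. -/
theorem norm_gradient_log_le_and_norm_sub_le {E : Type*} [NormedAddCommGroup E]
    [InnerProductSpace ℝ E] [CompleteSpace E] {g : E → ℝ} {g' : E → E →L[ℝ] ℝ} {c L : ℝ}
    (hc : 0 < c) (hL : 0 ≤ L) (hg : ∀ x, HasFDerivAt g (g' x) x) (hgc : ∀ x, c ≤ g x)
    (hbound : ∀ x, ‖g' x‖ ≤ L) (hlip : ∀ x y, ‖g' x - g' y‖ ≤ L * ‖x - y‖) :
    Differentiable ℝ (fun x => log (g x)) ∧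
    (∀ x, ‖gradient (fun y => log (g y)) x‖ ≤ L / c) ∧
    (∀ x y, ‖gradient (fun z => log (g z)) x - gradient (fun z => log (g z)) y‖ ≤
      (L / c + L ^ 2 / c ^ 2) * ‖x - y‖) := by
  have hpos : ∀ x, 0 < g x := fun x => hc.trans_le (hgc x)
  have hlog : ∀ x, HasFDerivAt (fun y => log (g y)) ((g x)⁻¹ • g' x) x := fun x =>
    (hg x).log (hpos x).ne'
  have hinv : ∀ x, (g x)⁻¹ ≤ c⁻¹ := fun x => inv_anti₀ hc (hgc x)
  have hinv0 : ∀ x, 0 ≤ (g x)⁻¹ := fun x => (inv_pos.2 (hpos x)).le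
  have hg_lip : ∀ x y, |g x - g y| ≤ L * ‖x - y‖ := fun x y =>
    convex_univ.norm_image_sub_le_of_norm_hasFDerivWithin_le
      (fun z _ => (hg z).hasFDerivWithinAt) (fun z _ => hbound z) trivial trivial
  have hinv_lip : ∀ x y, |(g x)⁻¹ - (g y)⁻¹| ≤ c⁻¹ * c⁻¹ * (L * ‖x - y‖) := fun x y => by
    rw [inv_sub_inv (hpos x).ne' (hpos y).ne', abs_div, abs_sub_comm,
      abs_of_pos (mul_pos (hpos x) (hpos y)), div_eq_inv_mul, mul_inv]
    have := hinv x
    have := hinv y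
    have := hinv0 x
    have := hinv0 y
    have := hg_lip x y
    gcongr
  refine ⟨fun x => (hlog x).differentiableAt, fun x => ?_, fun x y => ?_⟩
  · rw [gradient, LinearIsometryEquiv.norm_map, (hlog x).fderiv, norm_smul, norm_inv,
      Real.norm_of_nonneg (hpos x).le, div_eq_inv_mul]
    have := hinv x
    have := hinv0 x
    have := hbound x
    gcongr
  · rw [gradient, gradient, ← map_sub, LinearIsometryEquiv.norm_map, (hlog x).fderiv,
      (hlog y).fderiv]
    have hsplit : (g x)⁻¹ • g' x - (g y)⁻¹ • g' y =
        ((g x)⁻¹ - (g y)⁻¹) • g' x + (g y)⁻¹ • (g' x - g' y) := by module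
    calc ‖(g x)⁻¹ • g' x - (g y)⁻¹ • g' y‖
        ≤ |(g x)⁻¹ - (g y)⁻¹| * ‖g' x‖ + (g y)⁻¹ * ‖g' x - g' y‖ := by
          rw [hsplit]
          refine (norm_add_le _ _).trans_eq ?_
          rw [norm_smul, norm_smul, Real.norm_eq_abs, Real.norm_of_nonneg (hinv0 y)]
      _ ≤ c⁻¹ * c⁻¹ * (L * ‖x - y‖) * L + c⁻¹ * (L * ‖x - y‖) := by
          have := hinv_lip x y
          have := hbound x
          have := hinv y
          have := hinv0 y
          have := hlip x y
          gcongr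
      _ = (L / c + L ^ 2 / c ^ 2) * ‖x - y‖ := by
          field_simp
          ring

theorem norm_smul_fderiv_le {E : Type*} [NormedAddCommGroup E] [NormedSpace ℝ E]
    {f w : E → ℝ} {L : ℝ≥0} (hf : LipschitzWith L f) (hw0 : ∀ z, 0 ≤ w z)
    {a : ℝ} (ha0 : 0 ≤ a) (ha1 : a ≤ 1) (x z : E) : ‖w z • a • fderiv ℝ f x‖ ≤ L * w z := by
  rw [norm_smul, norm_smul, Real.norm_of_nonneg (hw0 z), Real.norm_of_nonneg ha0, mul_comm]
  refine mul_le_mul_of_nonneg_right ?_ (hw0 z)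
  exact (mul_le_of_le_one_left (norm_nonneg _) ha1).trans (norm_fderiv_le_of_lipschitz ℝ hf)

theorem norm_integral_smul_fderiv_le {E : Type*} [NormedAddCommGroup E] [NormedSpace ℝ E]
    [MeasurableSpace E] {μ : Measure E} {f w : E → ℝ} {L : ℝ≥0} (hf : LipschitzWith L f)
    (hw0 : ∀ z, 0 ≤ w z)
    (hwi : Integrable w μ) (hw1 : ∫ z, w z ∂μ = 1) {a : ℝ} (ha0 : 0 ≤ a) (ha1 : a ≤ 1)
    (s : ℝ) (y : E) : ‖∫ z, w z • a • fderiv ℝ f (a • y + s • z) ∂μ‖ ≤ L := by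
  have h := norm_integral_le_of_norm_le (hwi.const_mul (L : ℝ))
    (Filter.Eventually.of_forall fun z =>
      norm_smul_fderiv_le hf hw0 ha0 ha1 (a • y + s • z) z)
  rwa [integral_const_mul, hw1, mul_one] at h

section WeightedAverage

variable {E : Type*} [NormedAddCommGroup E] [NormedSpace ℝ E] [FiniteDimensional ℝ E]
  [MeasurableSpace E] [BorelSpace E] {μ : Measure E} {f : E → ℝ} {w : E → ℝ} {L : ℝ≥0}

theorem LipschitzWith.integrable_comp_mul_weight (hf : LipschitzWith L f)
    (hw : Continuous w) (hw0 : ∀ z, 0 ≤ w z) (hwi : Integrable w μ)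
    (hwi' : Integrable (fun z => ‖z‖ * w z) μ) (v : E) (s : ℝ) :
    Integrable (fun z => f (v + s • z) * w z) μ := by
  have hcont := hf.continuous
  refine ((hwi.const_mul |f v|).add (hwi'.const_mul (L * |s|))).mono'
    (by fun_prop) (Filter.Eventually.of_forall fun z => ?_)
  have h := hf.norm_sub_le (v + s • z) v
  rw [add_sub_cancel_left, norm_smul, Real.norm_eq_abs, Real.norm_eq_abs] at h
  have h' : |f (v + s • z)| ≤ |f v| + L * (|s| * ‖z‖) := by
    have := abs_sub_abs_le_abs_sub (f (v + s • z)) (f v)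
    linarith
  rw [norm_mul, Real.norm_eq_abs, Real.norm_of_nonneg (hw0 z)]
  calc |f (v + s • z)| * w z ≤ (|f v| + L * (|s| * ‖z‖)) * w z :=
        mul_le_mul_of_nonneg_right h' (hw0 z)
    _ = |f v| * w z + L * |s| * (‖z‖ * w z) := by ring

theorem integrable_smul_fderiv (hf : LipschitzWith L f) (hf' : Continuous (fderiv ℝ f))
    (hw : Continuous w) (hw0 : ∀ z, 0 ≤ w z) (hwi : Integrable w μ) {a : ℝ} (ha0 : 0 ≤ a)
    (ha1 : a ≤ 1) (s : ℝ) (y : E) :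
    Integrable (fun z => w z • a • fderiv ℝ f (a • y + s • z)) μ :=
  (hwi.const_mul (L : ℝ)).mono' (by fun_prop)
    (Filter.Eventually.of_forall fun z => norm_smul_fderiv_le hf hw0 ha0 ha1 _ z)

theorem hasFDerivAt_integral_comp_mul_weight (hfd : Differentiable ℝ f)
    (hf : LipschitzWith L f) (hf' : Continuous (fderiv ℝ f)) (hw : Continuous w)
    (hw0 : ∀ z, 0 ≤ w z) (hwi : Integrable w μ) (hwi' : Integrable (fun z => ‖z‖ * w z) μ)
    {a : ℝ} (ha0 : 0 ≤ a) (ha1 : a ≤ 1) (s : ℝ) (y : E) :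
    HasFDerivAt (fun y => ∫ z, f (a • y + s • z) * w z ∂μ)
      (∫ z, w z • a • fderiv ℝ f (a • y + s • z) ∂μ) y := by
  have hint := fun y => hf.integrable_comp_mul_weight hw hw0 hwi hwi' (a • y) s
  refine hasFDerivAt_integral_of_dominated_of_fderiv_le (s := Set.univ)
    (F' := fun y z => w z • a • fderiv ℝ f (a • y + s • z)) (bound := fun z => L * w z)
    Filter.univ_mem (Filter.Eventually.of_forall fun y => (hint y).aestronglyMeasurable) (hint y)
    (integrable_smul_fderiv hf hf' hw hw0 hwi ha0 ha1 s y).aestronglyMeasurable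
    (Filter.Eventually.of_forall fun z x _ => norm_smul_fderiv_le hf hw0 ha0 ha1 _ z)
    (hwi.const_mul _) (Filter.Eventually.of_forall fun z x _ => ?_)
  have hin : HasFDerivAt (fun x : E => a • x + s • z) (a • ContinuousLinearMap.id ℝ E) x :=
    ((hasFDerivAt_id x).const_smul a).add_const _
  have h := ((hfd (a • x + s • z)).hasFDerivAt.comp x hin).mul_const (w z)
  refine h.congr_fderiv ?_
  ext v
  simp

theorem norm_integral_smul_fderiv_sub_le (hf : LipschitzWith L f)
    (hf' : LipschitzWith L (fderiv ℝ f)) (hw : Continuous w) (hw0 : ∀ z, 0 ≤ w z)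
    (hwi : Integrable w μ) (hw1 : ∫ z, w z ∂μ = 1) {a : ℝ} (ha0 : 0 ≤ a) (ha1 : a ≤ 1)
    (s : ℝ) (x y : E) :
    ‖(∫ z, w z • a • fderiv ℝ f (a • x + s • z) ∂μ) -
      ∫ z, w z • a • fderiv ℝ f (a • y + s • z) ∂μ‖ ≤ L * ‖x - y‖ := by
  have hint := integrable_smul_fderiv hf hf'.continuous hw hw0 hwi ha0 ha1 s
  rw [← integral_sub (hint x) (hint y)]
  have h := norm_integral_le_of_norm_le (hwi.const_mul (L * ‖x - y‖))
    (f := fun z => w z • a • fderiv ℝ f (a • x + s • z) - w z • a • fderiv ℝ f (a • y + s • z))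
    (Filter.Eventually.of_forall fun z => by
      rw [← smul_sub, ← smul_sub, norm_smul, norm_smul, Real.norm_of_nonneg (hw0 z),
        Real.norm_of_nonneg ha0, mul_comm]
      refine mul_le_mul_of_nonneg_right ?_ (hw0 z)
      refine (mul_le_of_le_one_left (norm_nonneg _) ha1).trans ((hf'.norm_sub_le _ _).trans ?_)
      rw [add_sub_add_right_eq_sub, ← smul_sub, norm_smul, Real.norm_of_nonneg ha0]
      exact mul_le_mul_of_nonneg_left (mul_le_of_le_one_left (norm_nonneg _) ha1) L.2)
  rwa [integral_const_mul, hw1, mul_one] at h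

end WeightedAverage

section Gaussian

variable {V : Type*} [NormedAddCommGroup V] [InnerProductSpace ℝ V] [FiniteDimensional ℝ V]
  [MeasurableSpace V] [BorelSpace V]

theorem integrable_rexp_neg_mul_sq_norm {b : ℝ} (hb : 0 < b) :
    Integrable (fun v : V => exp (-b * ‖v‖ ^ 2)) := by
  have h := (GaussianFourier.integrable_cexp_neg_mul_sq_norm_add (V := V)
    (b := (b : ℂ)) (by simpa using hb) 0 0).norm
  refine h.congr (Filter.Eventually.of_forall fun v => ?_)
  simp [Complex.norm_exp, ← Complex.ofReal_pow]

theorem integrable_norm_mul_exp_neg_sq_norm_div_two :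
    Integrable (fun v : V => ‖v‖ * exp (-‖v‖ ^ 2 / 2)) := by
  refine (integrable_rexp_neg_mul_sq_norm (V := V) (b := 1 / 4) (by norm_num)).mono'
    (by fun_prop) (Filter.Eventually.of_forall fun v => ?_)
  rw [Real.norm_of_nonneg (by positivity)]
  have h : ‖v‖ ≤ exp (‖v‖ ^ 2 / 4) := by
    nlinarith [add_one_le_exp (‖v‖ ^ 2 / 4), sq_nonneg (‖v‖ - 2)]
  calc ‖v‖ * exp (-‖v‖ ^ 2 / 2) ≤ exp (‖v‖ ^ 2 / 4) * exp (-‖v‖ ^ 2 / 2) := by gcongr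
    _ = exp (-(1 / 4) * ‖v‖ ^ 2) := by
      rw [← exp_add]
      ring_nf

theorem integrable_exp_neg_sq_norm_div_two :
    Integrable (fun v : V => exp (-‖v‖ ^ 2 / 2)) := by
  convert integrable_rexp_neg_mul_sq_norm (V := V) (b := 1 / 2) (by norm_num) using 3
  ring

theorem integral_gaussian_density_eq_one :
    ∫ v : V, (2 * π) ^ (-(Module.finrank ℝ V : ℝ) / 2) * exp (-‖v‖ ^ 2 / 2) = 1 := by
  have h := GaussianFourier.integral_rexp_neg_mul_sq_norm (V := V) (b := 1 / 2) (by norm_num)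
  have hexp : ∀ v : V, exp (-‖v‖ ^ 2 / 2) = exp (-(1 / 2) * ‖v‖ ^ 2) := fun v => by ring_nf
  simp_rw [integral_const_mul, hexp]
  rw [h, show π / (1 / 2) = 2 * π by ring, ← rpow_add (by positivity), neg_div, neg_add_cancel,
    rpow_zero]

end Gaussian

/-- Under boundedness below and Lipschitzness of `f` and `∇f`, the vector field
`x ↦ ∇ log U_t f(x)` is well defined, bounded in norm by `L/c`, and Lipschitz with
constant `L/c + L²/c²`. -/
theorem stmt_11 (d : ℕ) (hd : 1 ≤ d)
    (f : EuclideanSpace ℝ (Fin d) → ℝ)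
    (hf_diff : Differentiable ℝ f)
    (c : ℝ) (hc : 0 < c) (hc1 : c ≤ 1) (hfc : ∀ x, c ≤ f x)
    (L : ℝ≥0) (hf_lip : LipschitzWith L f)
    (hgradf_lip : LipschitzWith L (fun x => gradient f x))
    (U : ℝ → EuclideanSpace ℝ (Fin d) → ℝ)
    (hU : ∀ t y, U t y =
      ∫ z, f (exp (-t) • y + Real.sqrt (1 - exp (-2 * t)) • z) *
        ((2 * π) ^ (-(d : ℝ) / 2) * exp (-‖z‖ ^ 2 / 2)))
    (t : ℝ) (ht : 0 ≤ t) :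
    Differentiable ℝ (fun y => Real.log (U t y)) ∧
    (∀ x, ‖gradient (fun y => Real.log (U t y)) x‖ ≤ L / c) ∧
    (∀ x y, ‖gradient (fun y' => Real.log (U t y')) x -
        gradient (fun y' => Real.log (U t y')) y‖ ≤
      (L / c + L ^ 2 / c ^ 2) * ‖x - y‖) := by
  set a := exp (-t)
  set s := Real.sqrt (1 - exp (-2 * t))
  set w : EuclideanSpace ℝ (Fin d) → ℝ := fun z =>
    (2 * π) ^ (-(d : ℝ) / 2) * exp (-‖z‖ ^ 2 / 2) with hw_def
  have ha0 : 0 ≤ a := (exp_pos _).le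
  have ha1 : a ≤ 1 := exp_le_one_iff.2 (by linarith)
  have hw : Continuous w := by fun_prop
  have hw0 : ∀ z, 0 ≤ w z := fun z => by positivity
  have hwi : Integrable w := integrable_exp_neg_sq_norm_div_two.const_mul _
  have hwi' : Integrable (fun z => ‖z‖ * w z) := by
    refine (integrable_norm_mul_exp_neg_sq_norm_div_two.const_mul
      ((2 * π) ^ (-(d : ℝ) / 2))).congr (Filter.Eventually.of_forall fun z => ?_)
    simp only [hw_def]
    ring
  have hw1 : ∫ z, w z = 1 := by
    simpa using integral_gaussian_density_eq_one (V := EuclideanSpace ℝ (Fin d))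
  have hf' : LipschitzWith L (fderiv ℝ f) := by
    refine LipschitzWith.of_dist_le_mul fun x y => ?_
    simpa [gradient] using hgradf_lip.dist_le_mul x y
  have hUt : U t = fun y => ∫ z, f (a • y + s • z) * w z := funext (hU t)
  have hUc : ∀ y, c ≤ U t y := fun y => by
    rw [hUt]
    calc c = ∫ z, c * w z := by rw [integral_const_mul, hw1, mul_one]
      _ ≤ ∫ z, f (a • y + s • z) * w z :=
        integral_mono (hwi.const_mul c)
          (hf_lip.integrable_comp_mul_weight hw hw0 hwi hwi' _ _)
          fun z => mul_le_mul_of_nonneg_right (hfc _) (hw0 z)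
  refine norm_gradient_log_le_and_norm_sub_le hc L.2 (fun y => ?_) hUc
    (norm_integral_smul_fderiv_le hf_lip hw0 hwi hw1 ha0 ha1 s)
    (norm_integral_smul_fderiv_sub_le hf_lip hf' hw hw0 hwi hw1 ha0 ha1 s)
  rw [hUt]
  exact hasFDerivAt_integral_comp_mul_weight hf_diff hf_lip hf'.continuous hw hw0 hwi hwi'
    ha0 ha1 s y
end
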